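/- Let K_n=(V,E⁺,E⁻) be a complete signed graph on n vertices that is (weakly) k-anti-balanced with negative components V_1,…,V_k, |V_1| ≥ … ≥ |V_k|. Assume 2|V_1| ≥ n, and assume it is not the case that both k=2 and |V_2| ≥ ⌈(n+1)/3⌉. Then a_so(K_n) = max{n−|V_1|+1, 2(n−|V_1|)}; moreover, if n−|V_1| ≥ 1, then for any S_1 ⊆ V_1 with |S_1| = n−|V_1|, the set S_1 ∪ (V∖V_1) is a minimum nonempty offensive alliance. -/

import Mathlib

/-- A signed graph on a vertex type `V`: a set of positive edges and a set of
negative edges, given as two simple graphs with disjoint edge sets. -/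
structure SignedGraph (V : Type*) where
  pos : SimpleGraph V
  neg : SimpleGraph V
  disj : ∀ u v : V, ¬ (pos.Adj u v ∧ neg.Adj u v)

namespace SignedGraph

variable {V : Type*}

/-- The positive neighborhood `N⁺(v)`. -/
def Np (G : SignedGraph V) (v : V) : Set V := {u | G.pos.Adj v u}

/-- The negative neighborhood `N⁻(v)`. -/
def Nn (G : SignedGraph V) (v : V) : Set V := {u | G.neg.Adj v u}

/-- The (open) neighborhood `N(v) = N⁺(v) ∪ N⁻(v)`. -/
def Nbr (G : SignedGraph V) (v : V) : Set V := G.Np v ∪ G.Nn v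

/-- The positive degree `deg⁺(v)`. -/
noncomputable def degp (G : SignedGraph V) (v : V) : ℕ := (G.Np v).ncard

/-- The negative degree `deg⁻(v)`. -/
noncomputable def degn (G : SignedGraph V) (v : V) : ℕ := (G.Nn v).ncard

/-- The positive degree with respect to a set `S`: `deg⁺_S(v) = |N⁺(v) ∩ S|`. -/
noncomputable def degpIn (G : SignedGraph V) (S : Set V) (v : V) : ℕ := (G.Np v ∩ S).ncard

/-- The negative degree with respect to a set `S`: `deg⁻_S(v) = |N⁻(v) ∩ S|`. -/
noncomputable def degnIn (G : SignedGraph V) (S : Set V) (v : V) : ℕ := (G.Nn v ∩ S).ncard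

/-- The boundary `∂S = (⋃_{v ∈ S} N(v)) \ S`. -/
def boundary (G : SignedGraph V) (S : Set V) : Set V := (⋃ v ∈ S, G.Nbr v) \ S

/-- `S` is an offensive alliance: every boundary vertex `v` satisfies
`deg⁻_S(v) ≥ deg⁺_S(v)` and `deg⁻_S(v) ≥ deg⁺_{S̄}(v) + 1`. -/
def IsOffensive (G : SignedGraph V) (S : Set V) : Prop :=
  ∀ v ∈ G.boundary S,
    G.degpIn S v ≤ G.degnIn S v ∧ G.degpIn Sᶜ v + 1 ≤ G.degnIn S v

/-- The offensive alliance number `a_so(G)`: the least size of a nonempty offensive alliance. -/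
noncomputable def aso (G : SignedGraph V) : ℕ :=
  sInf {n | ∃ S : Set V, S.Nonempty ∧ G.IsOffensive S ∧ S.ncard = n}

/-- `S` is a minimum-size nonempty offensive alliance. -/
def IsMinOffensive (G : SignedGraph V) (S : Set V) : Prop :=
  S.Nonempty ∧ G.IsOffensive S ∧
    ∀ T : Set V, T.Nonempty → G.IsOffensive T → S.ncard ≤ T.ncard

/-- The minimum positive degree `δ⁺(G)`. -/
noncomputable def minPosDeg (G : SignedGraph V) : ℕ := sInf (Set.range G.degp)

/-- The maximum negative degree `Δ⁻(G)`. -/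
noncomputable def maxNegDeg (G : SignedGraph V) : ℕ := sSup (Set.range G.degn)

/-- The underlying unsigned graph `(V, E⁺ ∪ E⁻)`. -/
def underlying (G : SignedGraph V) : SimpleGraph V := G.pos ⊔ G.neg

/-- `G` is connected if its underlying unsigned graph is connected. -/
def Connected (G : SignedGraph V) : Prop := G.underlying.Connected

/-- `G` is a complete signed graph that is (weakly) `k`-balanced with positive components
`P 0, …, P (k-1)`: the `P i` are nonempty, pairwise disjoint, cover `V`, the positive edges
are exactly the pairs of distinct vertices inside a common part, and the negative edges are
exactly the pairs of distinct vertices in no common part. -/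
def IsKBalanced (G : SignedGraph V) (k : ℕ) (P : Fin k → Set V) : Prop :=
  (∀ i, (P i).Nonempty) ∧
  (∀ i j : Fin k, i ≠ j → Disjoint (P i) (P j)) ∧
  (⋃ i, P i) = Set.univ ∧
  (∀ u v : V, G.pos.Adj u v ↔ u ≠ v ∧ ∃ i, u ∈ P i ∧ v ∈ P i) ∧
  (∀ u v : V, G.neg.Adj u v ↔ u ≠ v ∧ ¬ ∃ i, u ∈ P i ∧ v ∈ P i)

/-- `G` is a complete signed graph that is (weakly) `k`-anti-balanced with negative components
`P 0, …, P (k-1)`. -/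
def IsKAntiBalanced (G : SignedGraph V) (k : ℕ) (P : Fin k → Set V) : Prop :=
  (∀ i, (P i).Nonempty) ∧
  (∀ i j : Fin k, i ≠ j → Disjoint (P i) (P j)) ∧
  (⋃ i, P i) = Set.univ ∧
  (∀ u v : V, G.neg.Adj u v ↔ u ≠ v ∧ ∃ i, u ∈ P i ∧ v ∈ P i) ∧
  (∀ u v : V, G.pos.Adj u v ↔ u ≠ v ∧ ¬ ∃ i, u ∈ P i ∧ v ∈ P i)

/-- `V` can be partitioned into `t` classes such that vertices in a common class have the same
positive neighborhoods and the same negative neighborhoods (up to each other). -/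
def GoodSndPartition (G : SignedGraph V) (t : ℕ) : Prop :=
  ∃ C : Fin t → Set V,
    (⋃ i, C i) = Set.univ ∧
    (∀ i j : Fin t, i ≠ j → Disjoint (C i) (C j)) ∧
    ∀ i : Fin t, ∀ u ∈ C i, ∀ v ∈ C i,
      G.Np v \ {u} = G.Np u \ {v} ∧ G.Nn v \ {u} = G.Nn u \ {v}

/-- The signed neighborhood diversity `snd(G)`. -/
noncomputable def snd (G : SignedGraph V) : ℕ := sInf {t | G.GoodSndPartition t}

/-- The signed subgraph induced on a set `W` of vertices. -/
def restrict (G : SignedGraph V) (W : Set V) : SignedGraph W where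
  pos := G.pos.induce W
  neg := G.neg.induce W
  disj := fun u v h => G.disj u.val v.val h

end SignedGraph

namespace SignedGraph

theorem IsKAntiBalanced.Nn_inter {V : Type*} {G : SignedGraph V} {k : ℕ} {P : Fin k → Set V}
    (h : G.IsKAntiBalanced k P) {i : Fin k} {v : V} (hv : v ∈ P i) {S : Set V} (hS : v ∉ S) :
    G.Nn v ∩ S = S ∩ P i := by
  obtain ⟨-, hdis, -, hneg, -⟩ := h
  ext u
  simp only [Nn, Set.mem_inter_iff, Set.mem_ofPred_eq, hneg]
  constructor
  · rintro ⟨⟨-, j, hvj, huj⟩, hu⟩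
    obtain rfl : i = j := by
      by_contra hij
      exact Set.disjoint_left.mp (hdis i j hij) hv hvj
    exact ⟨hu, huj⟩
  · rintro ⟨hu, hui⟩
    exact ⟨⟨fun e => hS (e ▸ hu), i, hv, hui⟩, hu⟩

theorem IsKAntiBalanced.Np_eq {V : Type*} {G : SignedGraph V} {k : ℕ} {P : Fin k → Set V}
    (h : G.IsKAntiBalanced k P) {i : Fin k} {v : V} (hv : v ∈ P i) :
    G.Np v = (P i)ᶜ := by
  obtain ⟨-, hdis, -, -, hpos⟩ := h
  ext u
  simp only [Np, Set.mem_ofPred_eq, Set.mem_compl_iff, hpos]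
  constructor
  · rintro ⟨-, hn⟩ hu
    exact hn ⟨i, hv, hu⟩
  · intro hu
    refine ⟨fun e => hu (e ▸ hv), ?_⟩
    rintro ⟨j, hvj, huj⟩
    obtain rfl : i = j := by
      by_contra hij
      exact Set.disjoint_left.mp (hdis i j hij) hv hvj
    exact hu huj

theorem IsKAntiBalanced.mem_boundary_iff {V : Type*} {G : SignedGraph V} {k : ℕ}
    {P : Fin k → Set V} (h : G.IsKAntiBalanced k P) {S : Set V} (hS : S.Nonempty) {v : V} :
    v ∈ G.boundary S ↔ v ∉ S := by
  obtain ⟨-, -, -, hneg, hpos⟩ := h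
  refine ⟨fun hv => hv.2, fun hv => ⟨?_, hv⟩⟩
  obtain ⟨u, hu⟩ := hS
  have huv : u ≠ v := fun e => hv (e ▸ hu)
  refine Set.mem_biUnion hu ?_
  by_cases hc : ∃ i, u ∈ P i ∧ v ∈ P i
  · exact Or.inr ((hneg u v).2 ⟨huv, hc⟩)
  · exact Or.inl ((hpos u v).2 ⟨huv, hc⟩)

/-- In an anti-balanced complete signed graph, whether a nonempty set is an offensive alliance
depends only on its size and the sizes of its intersections with the negative components. -/
theorem IsKAntiBalanced.isOffensive_iff {V : Type*} [Fintype V] {G : SignedGraph V} {k : ℕ}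
    {P : Fin k → Set V} (h : G.IsKAntiBalanced k P) {S : Set V} (hS : S.Nonempty) :
    G.IsOffensive S ↔ ∀ i, ¬ P i ⊆ S →
      S.ncard ≤ 2 * (S ∩ P i).ncard ∧ Fintype.card V + 1 ≤ S.ncard + (P i).ncard := by
  have key : ∀ i, ∀ v ∈ P i, v ∉ S →
      ((G.degpIn S v ≤ G.degnIn S v ∧ G.degpIn Sᶜ v + 1 ≤ G.degnIn S v) ↔
      (S.ncard ≤ 2 * (S ∩ P i).ncard ∧ Fintype.card V + 1 ≤ S.ncard + (P i).ncard)) := by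
    intro i v hv hvS
    have hpS : (P i)ᶜ ∩ S = S \ P i := by
      rw [Set.inter_comm, Set.sdiff_eq]
    have hpC : (P i)ᶜ ∩ Sᶜ = (S ∪ P i)ᶜ := by
      rw [Set.compl_union, Set.inter_comm]
    simp only [degpIn, degnIn, h.Nn_inter hv hvS, h.Np_eq hv, hpS, hpC]
    have h1 := Set.ncard_inter_add_ncard_sdiff_eq_ncard S (P i)
    have h2 := Set.ncard_union_add_ncard_inter S (P i)
    have h3 := Set.ncard_add_ncard_compl (S ∪ P i)
    rw [Nat.card_eq_fintype_card] at h3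
    omega
  constructor
  · intro hoff i hi
    obtain ⟨v, hv, hvS⟩ := Set.not_subset.mp hi
    exact (key i v hv hvS).1 (hoff v ((h.mem_boundary_iff hS).2 hvS))
  · intro hall v hvb
    have hvS := hvb.2
    have hvU : v ∈ ⋃ i, P i := h.2.2.1 ▸ Set.mem_univ v
    obtain ⟨i, hi⟩ := Set.mem_iUnion.1 hvU
    exact (key i v hi hvS).2 (hall i (Set.not_subset.2 ⟨v, hi, hvS⟩))

theorem IsKAntiBalanced.ncard_inter_add_le {V : Type*} [Fintype V] {G : SignedGraph V} {k : ℕ}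
    {P : Fin k → Set V} (h : G.IsKAntiBalanced k P) (S : Set V) {i j : Fin k} (hij : i ≠ j) :
    (S ∩ P i).ncard + (S ∩ P j).ncard ≤ S.ncard := by
  rw [← Set.ncard_union_eq ((h.2.1 i j hij).mono Set.inter_subset_right Set.inter_subset_right)]
  exact Set.ncard_le_ncard (Set.union_subset Set.inter_subset_left Set.inter_subset_left)

theorem IsKAntiBalanced.ncard_inter_add_add_le {V : Type*} [Fintype V] {G : SignedGraph V}
    {k : ℕ} {P : Fin k → Set V} (h : G.IsKAntiBalanced k P) (S : Set V) {i j l : Fin k}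
    (hij : i ≠ j) (hil : i ≠ l) (hjl : j ≠ l) :
    (S ∩ P i).ncard + (S ∩ P j).ncard + (S ∩ P l).ncard ≤ S.ncard := by
  have hd : ∀ {a b : Fin k}, a ≠ b → Disjoint (S ∩ P a) (S ∩ P b) := fun hab =>
    (h.2.1 _ _ hab).mono Set.inter_subset_right Set.inter_subset_right
  rw [← Set.ncard_union_eq (hd hij),
    ← Set.ncard_union_eq (Set.disjoint_union_left.2 ⟨hd hil, hd hjl⟩)]
  exact Set.ncard_le_ncard (Set.union_subset
    (Set.union_subset Set.inter_subset_left Set.inter_subset_left) Set.inter_subset_left)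

theorem IsKAntiBalanced.le_ncard_of_isOffensive {V : Type*} [Fintype V] {G : SignedGraph V}
    {k : ℕ} (hk : 1 ≤ k) {P : Fin k → Set V} (h : G.IsKAntiBalanced k P)
    (hsort : ∀ i j : Fin k, i ≤ j → (P j).ncard ≤ (P i).ncard)
    (hbig : Fintype.card V ≤ 2 * (P ⟨0, hk⟩).ncard)
    (hnot : k = 2 → ∀ j : Fin k, j.val = 1 → (P j).ncard < (Fintype.card V + 3) / 3)
    {S : Set V} (hS : S.Nonempty) (hoff : G.IsOffensive S) :
    max (Fintype.card V - (P ⟨0, hk⟩).ncard + 1)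
      (2 * (Fintype.card V - (P ⟨0, hk⟩).ncard)) ≤ S.ncard := by
  rw [h.isOffensive_iff hS] at hoff
  set z : Fin k := ⟨0, hk⟩ with hz
  have hzpos : 0 < (P z).ncard := (Set.ncard_pos).2 (h.1 z)
  have hlt : ∀ i, ¬ P i ⊆ S → (S ∩ P i).ncard < (P i).ncard := fun i hi =>
    Set.ncard_lt_ncard (Set.inter_subset_right.ssubset_of_ne
      fun e => hi (Set.inter_eq_right.1 e))
  have hsplit := Set.ncard_inter_add_ncard_sdiff_eq_ncard S (P z)
  have hcompl := Set.ncard_add_ncard_compl (P z)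
  rw [Nat.card_eq_fintype_card] at hcompl
  by_cases hall : ∀ j, j ≠ z → P j ⊆ S
  · have hdiff : S \ P z = (P z)ᶜ := by
      refine Set.Subset.antisymm (fun v hv => hv.2) fun v hv => ⟨?_, hv⟩
      have hvU : v ∈ ⋃ i, P i := h.2.2.1 ▸ Set.mem_univ v
      obtain ⟨i, hi⟩ := Set.mem_iUnion.1 hvU
      exact hall i (fun e => hv (e ▸ hi)) hi
    rw [hdiff] at hsplit
    by_cases hzS : P z ⊆ S
    · rw [Set.inter_eq_right.2 hzS] at hsplit
      omega
    · have := hoff z hzS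
      omega
  · exfalso
    push Not at hall
    obtain ⟨j, hjz, hj⟩ := hall
    have hj1 := hoff j hj
    have hj2 := hlt j hj
    have hadd := h.ncard_inter_add_le S hjz
    have hjle := hsort z j (Fin.mk_le_mk.2 (Nat.zero_le _))
    by_cases hzS : P z ⊆ S
    · rw [Set.inter_eq_right.2 hzS] at hadd
      omega
    · have hz1 := hoff z hzS
      have hjval : j.val ≠ 0 := fun e => hjz (Fin.ext e)
      by_cases hk2 : k = 2
      · have := hnot hk2 j (by omega)
        omega
      · have hjk := j.isLt
        obtain ⟨l, hlz, hlj⟩ : ∃ l : Fin k, l ≠ z ∧ l ≠ j := by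
          by_cases hjone : j.val = 1
          · exact ⟨⟨2, by omega⟩, by simp [hz], by simp [Fin.ext_iff, hjone]⟩
          · exact ⟨⟨1, by omega⟩, by simp [hz], by simp only [ne_eq, Fin.ext_iff]; omega⟩
        have hthree := h.ncard_inter_add_add_le S hjz hlj.symm hlz.symm
        have hSpos : 0 < S.ncard := (Set.ncard_pos).2 hS
        have hlpos : 0 < (P l).ncard := (Set.ncard_pos).2 (h.1 l)
        by_cases hl : P l ⊆ S
        · rw [Set.inter_eq_right.2 hl] at hthree
          omega
        · have := hoff l hl
          omega

theorem IsKAntiBalanced.isOffensive_union_compl {V : Type*} [Fintype V] {G : SignedGraph V}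
    {k : ℕ} {P : Fin k → Set V} (h : G.IsKAntiBalanced k P) {z : Fin k} {T : Set V}
    (hT : T ⊆ P z) (hne : T.Nonempty) (hcard : Fintype.card V - (P z).ncard ≤ T.ncard) :
    G.IsOffensive (T ∪ (P z)ᶜ) ∧
      (T ∪ (P z)ᶜ).ncard = T.ncard + (Fintype.card V - (P z).ncard) := by
  have hcompl := Set.ncard_add_ncard_compl (P z)
  rw [Nat.card_eq_fintype_card] at hcompl
  have hunion : (T ∪ (P z)ᶜ).ncard = T.ncard + (P z)ᶜ.ncard :=
    Set.ncard_union_eq (Set.disjoint_compl_right_iff_subset.2 hT)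
  have hpos : 0 < T.ncard := (Set.ncard_pos).2 hne
  refine ⟨(h.isOffensive_iff (hne.mono Set.subset_union_left)).2 fun i hi => ?_, by omega⟩
  obtain rfl : i = z := by
    by_contra hiz
    exact hi fun v hv => Or.inr fun hvz => Set.disjoint_left.1 (h.2.1 i z hiz) hv hvz
  have hinter : (T ∪ (P i)ᶜ) ∩ P i = T := by
    rw [Set.union_inter_distrib_right, Set.compl_inter_self, Set.union_empty,
      Set.inter_eq_left.2 hT]
  rw [hinter]
  omega

end SignedGraph

theorem signed_anti_balanced_aso_big_component {V : Type*} [Fintype V]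
    (G : SignedGraph V) (k : ℕ) (hk : 1 ≤ k) (P : Fin k → Set V)
    (hanti : G.IsKAntiBalanced k P)
    (hsort : ∀ i j : Fin k, i ≤ j → (P j).ncard ≤ (P i).ncard)
    (hbig : Fintype.card V ≤ 2 * (P ⟨0, hk⟩).ncard)
    (hnot : ¬ ∃ h : k = 2,
      (Fintype.card V + 3) / 3 ≤ (P ⟨1, by omega⟩).ncard) :
    G.aso = max (Fintype.card V - (P ⟨0, hk⟩).ncard + 1)
        (2 * (Fintype.card V - (P ⟨0, hk⟩).ncard)) ∧
      (1 ≤ Fintype.card V - (P ⟨0, hk⟩).ncard →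
        ∀ S1 : Set V, S1 ⊆ P ⟨0, hk⟩ →
          S1.ncard = Fintype.card V - (P ⟨0, hk⟩).ncard →
          G.IsMinOffensive (S1 ∪ (P ⟨0, hk⟩)ᶜ)) := by
  have hlower := fun (T : Set V) (hT : T.Nonempty) (hoff : G.IsOffensive T) =>
    hanti.le_ncard_of_isOffensive hk hsort hbig
      (by
        rintro h ⟨_, _⟩ rfl
        by_contra hc
        exact hnot ⟨h, not_lt.1 hc⟩)
      hT hoff
  set z : Fin k := ⟨0, hk⟩
  constructor
  · have hzpos : 0 < (P z).ncard := (Set.ncard_pos).2 (hanti.1 z)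
    obtain ⟨T, hTP, hTcard⟩ := Set.exists_subset_card_eq
      (s := P z) (n := max 1 (Fintype.card V - (P z).ncard)) (by omega)
    have hTne : T.Nonempty := (Set.ncard_pos).1 (by omega)
    obtain ⟨hoff, hcard⟩ := hanti.isOffensive_union_compl hTP hTne (by omega)
    have hne : (T ∪ (P z)ᶜ).Nonempty := hTne.mono Set.subset_union_left
    refine IsLeast.csInf_eq ⟨⟨T ∪ (P z)ᶜ, hne, hoff, by omega⟩, ?_⟩
    rintro _ ⟨S, hS, hSoff, rfl⟩
    exact hlower S hS hSoff
  · intro hpos S1 hS1 hS1card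
    have hne : S1.Nonempty := (Set.ncard_pos).1 (by omega)
    obtain ⟨hoff, hcard⟩ := hanti.isOffensive_union_compl hS1 hne hS1card.ge
    refine ⟨hne.mono Set.subset_union_left, hoff, fun T hT hToff => ?_⟩
    have := hlower T hT hToff
    omega
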